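/- arXiv:1711.05762 — 3 statements merged into one kernel-verified Lean document; each statement's English description precedes it below -/
import Mathlib

section
/- Let U ⊆ ℝⁿ be a closed convex set and ũ ∈ U. Let w: U → ℝ be convex and W(ũ, u) = w(u) − w(ũ) − ⟨w'(ũ), u − ũ⟩ for some subgradient w'(ũ) ∈ ∂w(ũ). Suppose q: U → ℝ satisfies q(u₁) − q(u₂) − ⟨q'(u₂), u₁ − u₂⟩ ≥ μ₀·W(u₂, u₁) for all u₁, u₂ ∈ U (for some subgradient selection q' and some μ₀ ≥ 0), and the scalars μ₁, μ₂ satisfy μ₀ + μ₁ + μ₂ ≥ 0. If u* ∈ Argmin_{u∈U} {q(u) + μ₁ w(u) + μ₂ W(ũ, u)}, then for every u ∈ U: q(u*) + μ₁ w(u*) + μ₂ W(ũ, u*) + (μ₀ + μ₁ + μ₂)·W(u*, u) ≤ q(u) + μ₁ w(u) + μ₂ W(ũ, u). -/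
open scoped RealInnerProductSpace BigOperators

/-- Vectors in the linear span of the differences of a convex set are multiples of single
differences. -/
lemma Convex.exists_pos_smul_sub_eq_of_mem_vectorSpan {E : Type*} [AddCommGroup E] [Module ℝ E]
    {U : Set E} (hU : Convex ℝ U) (hne : U.Nonempty) {v : E} (hv : v ∈ vectorSpan ℝ U) :
    ∃ c : ℝ, 0 < c ∧ ∃ a ∈ U, ∃ b ∈ U, c • (a - b) = v := by
  obtain ⟨x₀, hx₀⟩ := hne
  induction hv using Submodule.span_induction with
  | mem v hv =>
    obtain ⟨a, ha, b, hb, rfl⟩ := hv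
    exact ⟨1, one_pos, a, ha, b, hb, by simp⟩
  | zero => exact ⟨1, one_pos, x₀, hx₀, x₀, hx₀, by simp⟩
  | add v v' _ _ hv hv' =>
    obtain ⟨c, hc, a, ha, b, hb, rfl⟩ := hv
    obtain ⟨c', hc', a', ha', b', hb', rfl⟩ := hv'
    have hs : 0 < c + c' := add_pos hc hc'
    have hsum : c / (c + c') + c' / (c + c') = 1 := by field_simp
    refine ⟨c + c', hs, (c / (c + c')) • a + (c' / (c + c')) • a',
      hU ha ha' (by positivity) (by positivity) hsum,
      (c / (c + c')) • b + (c' / (c + c')) • b',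
      hU hb hb' (by positivity) (by positivity) hsum, ?_⟩
    match_scalars <;> field_simp
  | smul t v _ hv =>
    obtain ⟨c, hc, a, ha, b, hb, rfl⟩ := hv
    rcases lt_trichotomy t 0 with ht | rfl | ht
    · exact ⟨-t * c, mul_pos (neg_pos.2 ht) hc, b, hb, a, ha, by module⟩
    · exact ⟨1, one_pos, x₀, hx₀, x₀, hx₀, by simp⟩
    · exact ⟨t * c, mul_pos ht hc, a, ha, b, hb, by module⟩

/-- At a minimizer of a sum of two convex functions that are finite on the same convex set, some
linear functional is a subgradient of the first function and its negative is a subgradient of the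
second. -/
lemma ConvexOn.exists_linearMap_of_isMinOn_add {E : Type*} [AddCommGroup E] [Module ℝ E]
    {U : Set E} {f g : E → ℝ} (hf : ConvexOn ℝ U f) (hg : ConvexOn ℝ U g) {x₀ : E} (hx₀ : x₀ ∈ U)
    (hmin : ∀ u ∈ U, f x₀ + g x₀ ≤ f u + g u) :
    ∃ l : E →ₗ[ℝ] ℝ, ∀ u ∈ U, f x₀ + l (u - x₀) ≤ f u ∧ g x₀ - l (u - x₀) ≤ g u := by
  let V : Submodule ℝ E := vectorSpan ℝ U
  let K : Set (V × ℝ) :=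
    {p | ∃ a ∈ U, ∃ b ∈ U, (p.1 : E) = a - b ∧ f a - f x₀ + (g b - g x₀) ≤ p.2}
  have hK : Convex ℝ K := by
    rintro ⟨v, r⟩ ⟨a, ha, b, hb, hv, hr⟩ ⟨v', r'⟩ ⟨a', ha', b', hb', hv', hr'⟩ s t hs ht hst
    refine ⟨s • a + t • a', hf.1 ha ha' hs ht hst, s • b + t • b', hf.1 hb hb' hs ht hst, ?_, ?_⟩
    · simp only [Prod.smul_mk, Prod.mk_add_mk, Submodule.coe_add, Submodule.coe_smul] at hv hv' ⊢
      rw [hv, hv']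
      module
    · have h₁ := hf.2 ha ha' hs ht hst
      have h₂ := hg.2 hb hb' hs ht hst
      simp only [Prod.smul_mk, Prod.mk_add_mk, smul_eq_mul] at h₁ h₂ hr hr' ⊢
      obtain rfl : t = 1 - s := by linarith
      nlinarith [mul_le_mul_of_nonneg_left hr hs, mul_le_mul_of_nonneg_left hr' ht]
  have hC {p : V × ℝ} : p ∈ ConvexCone.hull ℝ K ↔ ∃ c : ℝ, 0 < c ∧ ∃ y ∈ K, c • y = p :=
    ConvexCone.mem_hull_of_convex hK
  have hK0 : (0 : V × ℝ) ∈ K := ⟨x₀, hx₀, x₀, hx₀, by simp, by simp⟩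
  obtain ⟨φ, hφ, hφK⟩ := riesz_extension
    ((ConvexCone.hull ℝ K).toPointedCone (ConvexCone.subset_hull hK0))
    ⟨Submodule.prod ⊥ ⊤, (LinearMap.snd ℝ V ℝ).domRestrict _⟩
    (by
      rintro ⟨⟨v₀, r₀⟩, hx⟩ hxK
      obtain rfl : v₀ = 0 := hx.1
      obtain ⟨c, hc, ⟨v, r⟩, ⟨a, ha, b, hb, hv, hr⟩, hcv⟩ := hC.1 hxK
      simp only [Prod.smul_mk, smul_eq_mul, Prod.mk.injEq, smul_eq_zero, hc.ne', false_or]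
        at hcv hv hr
      obtain ⟨rfl, rfl⟩ := hcv
      obtain rfl : a = b := sub_eq_zero.1 (by simpa using hv.symm)
      have := hmin a ha
      exact mul_nonneg hc.le (by linarith))
    (by
      rintro ⟨v, r⟩
      obtain ⟨c, hc, a, ha, b, hb, hv⟩ :=
        hf.1.exists_pos_smul_sub_eq_of_mem_vectorSpan ⟨x₀, hx₀⟩ v.2
      let d : ℝ := f a - f x₀ + (g b - g x₀)
      refine ⟨⟨(0, c * d - r), by simp⟩, ?_⟩
      refine hC.2 ⟨c, hc, (c⁻¹ • v, d), ⟨a, ha, b, hb, ?_, le_rfl⟩, ?_⟩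
      · simp [← hv, smul_smul, hc.ne']
      · simp [smul_smul, hc.ne'])
  have hφ1 : φ (0, 1) = 1 := hφ ⟨(0, 1), by simp⟩
  have hφ_apply (v : V) (r : ℝ) : φ (v, r) = φ (v, 0) + r := by
    have : ((v, r) : V × ℝ) = (v, 0) + r • (0, 1) := by simp
    rw [this, map_add, map_smul, hφ1, smul_eq_mul, mul_one]
  have hφ_nonneg (a : E) (ha : a ∈ U) (b : E) (hb : b ∈ U) :
      0 ≤ φ (⟨a - b, vsub_mem_vectorSpan ℝ ha hb⟩, 0) + (f a - f x₀ + (g b - g x₀)) := by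
    rw [← hφ_apply]
    exact hφK _ (hC.2 ⟨1, one_pos, _, ⟨a, ha, b, hb, rfl, le_rfl⟩, one_smul _ _⟩)
  obtain ⟨l, hl⟩ := LinearMap.exists_extend (φ ∘ₗ LinearMap.inl ℝ V ℝ)
  have hl_apply (v : V) : l v = φ (v, 0) := LinearMap.congr_fun hl v
  refine ⟨-l, fun u hu => ?_⟩
  have h₁ := hφ_nonneg u hu x₀ hx₀
  have h₂ := hφ_nonneg x₀ hx₀ u hu
  rw [← hl_apply] at h₁ h₂
  simp only [LinearMap.neg_apply, map_sub] at h₁ h₂ ⊢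
  constructor <;> linarith

/-- A function with a subgradient at every point of a convex set is convex on it. -/
lemma convexOn_of_forall_subgradient {E : Type*} [NormedAddCommGroup E] [InnerProductSpace ℝ E]
    {U : Set E} (hU : Convex ℝ U) {f : E → ℝ} {f' : E → E}
    (hf : ∀ u ∈ U, ∀ v ∈ U, f u + ⟪f' u, v - u⟫ ≤ f v) : ConvexOn ℝ U f := by
  refine ⟨hU, fun x hx y hy s t hs ht hst => ?_⟩
  have hz := hU hx hy hs ht hst
  set z := s • x + t • y with hz_def
  have h : s * ⟪f' z, x - z⟫ + t * ⟪f' z, y - z⟫ = 0 := by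
    rw [← inner_smul_right, ← inner_smul_right, ← inner_add_right]
    have : s • (x - z) + t • (y - z) = (s • x + t • y) - (s + t) • z := by module
    rw [this, hst, one_smul, ← hz_def, sub_self, inner_zero_right]
  have h₁ := mul_le_mul_of_nonneg_left (hf z hz x hx) hs
  have h₂ := mul_le_mul_of_nonneg_left (hf z hz y hy) ht
  have h₃ : s * f z + t * f z = f z := by rw [← add_mul, hst, one_mul]
  simp only [smul_eq_mul]
  linarith

/-- **Characterization of the solutions of the prox-mapping subproblem (Lemma 3.1).**
`w'` is a subgradient selection for `w` on `U`; the conclusion asserts the existence of an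
appropriate subgradient of `w` at `u*` (the one satisfying the first-order optimality
condition) for which the claimed inequality holds for all `u ∈ U`. -/
theorem prox_mapping_characterization
    {n : ℕ}
    (U : Set (EuclideanSpace ℝ (Fin n))) (hUconv : Convex ℝ U) (hUcl : IsClosed U)
    (utilde : EuclideanSpace ℝ (Fin n)) (hutilde : utilde ∈ U)
    (w : EuclideanSpace ℝ (Fin n) → ℝ) (hwconv : ConvexOn ℝ U w)
    -- w' is a subgradient selection of w on U
    (w' : EuclideanSpace ℝ (Fin n) → EuclideanSpace ℝ (Fin n))
    (hw' : ∀ u ∈ U, ∀ v ∈ U, w u + ⟪w' u, v - u⟫ ≤ w v)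
    (q : EuclideanSpace ℝ (Fin n) → ℝ) (q' : EuclideanSpace ℝ (Fin n) → EuclideanSpace ℝ (Fin n))
    (μ0 μ1 μ2 : ℝ) (hμ0 : 0 ≤ μ0)
    -- q(u₁) − q(u₂) − ⟨q'(u₂), u₁ − u₂⟩ ≥ μ₀ W(u₂, u₁) on U
    (hq : ∀ u₁ ∈ U, ∀ u₂ ∈ U,
      q u₁ - q u₂ - ⟪q' u₂, u₁ - u₂⟫ ≥ μ0 * (w u₁ - w u₂ - ⟪w' u₂, u₁ - u₂⟫))
    (hμsum : 0 ≤ μ0 + μ1 + μ2)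
    (ustar : EuclideanSpace ℝ (Fin n)) (hustar : ustar ∈ U)
    -- u* minimizes q + μ₁ w + μ₂ W(ũ, ·) over U
    (hmin : ∀ u ∈ U,
      q ustar + μ1 * w ustar + μ2 * (w ustar - w utilde - ⟪w' utilde, ustar - utilde⟫)
        ≤ q u + μ1 * w u + μ2 * (w u - w utilde - ⟪w' utilde, u - utilde⟫)) :
    ∃ s : EuclideanSpace ℝ (Fin n),
      (∀ v ∈ U, w ustar + ⟪s, v - ustar⟫ ≤ w v)
        ∧ ∀ u ∈ U,
          q ustar + μ1 * w ustar + μ2 * (w ustar - w utilde - ⟪w' utilde, ustar - utilde⟫)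
              + (μ0 + μ1 + μ2) * (w u - w ustar - ⟪s, u - ustar⟫)
            ≤ q u + μ1 * w u + μ2 * (w u - w utilde - ⟪w' utilde, u - utilde⟫) := by
  rcases hμsum.eq_or_lt with hM | hM
  · refine ⟨w' ustar, hw' ustar hustar, fun u hu => ?_⟩
    rw [← hM, zero_mul, add_zero]
    exact hmin u hu
  set M := μ0 + μ1 + μ2 with hM_def
  let h : EuclideanSpace ℝ (Fin n) → ℝ := fun u => q u - μ0 * w u - μ2 * ⟪w' utilde, u⟫
  have hh : ConvexOn ℝ U h := by
    refine convexOn_of_forall_subgradient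
      (f' := fun u => q' u - μ0 • w' u - μ2 • w' utilde) hUconv fun u hu v hv => ?_
    have := hq v hv u hu
    simp only [h, inner_sub_left, inner_sub_right, real_inner_smul_left] at this ⊢
    linarith
  obtain ⟨l, hl⟩ := (hwconv.smul hM.le).exists_linearMap_of_isMinOn_add hh hustar
    (fun u hu => by
      have := hmin u hu
      simp only [h, hM_def, smul_eq_mul, inner_sub_right] at this ⊢
      linarith)
  obtain ⟨s, hs⟩ : ∃ s, ∀ x, ⟪s, x⟫ = l x :=
    ⟨(InnerProductSpace.toDual ℝ _).symm l.toContinuousLinearMap, fun x => by simp⟩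
  have hMs (x : EuclideanSpace ℝ (Fin n)) : M * ⟪M⁻¹ • s, x⟫ = l x := by
    rw [real_inner_smul_left, hs, mul_inv_cancel_left₀ hM.ne']
  refine ⟨M⁻¹ • s, fun v hv => ?_, fun u hu => ?_⟩
  · refine le_of_mul_le_mul_left ?_ hM
    rw [mul_add, hMs]
    exact (hl v hv).1
  · have := (hl u hu).2
    have hMu := hMs (u - ustar)
    simp only [h, hM_def, inner_sub_right] at this hMu ⊢
    linarith
end

section
/- Let f: ℝⁿ → ℝ be convex and differentiable with ‖∇f(x₁) − ∇f(x₂)‖_* ≤ L_f‖x₁ − x₂‖, and let J_f be the convex conjugate of f, so that f(x) = max_{g} {⟨x, g⟩ − J_f(g)}. Let x̃ ∈ X and g⁰ ∈ 𝒢 be given, let J_f'(g⁰) be a subgradient of J_f at g⁰, and define D_f(g⁰, g) = J_f(g) − J_f(g⁰) − ⟨J_f'(g⁰), g − g⁰⟩. For any τ > 0, setting z = (x̃ + τ·J_f'(g⁰))/(1 + τ), one has ∇f(z) = argmin_{g ∈ 𝒢} {⟨−x̃, g⟩ + J_f(g) + τ·D_f(g⁰, g)}. -/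
open scoped RealInnerProductSpace BigOperators

/-- First-order convexity inequality: a convex function lies above its tangent hyperplanes. -/
theorem ConvexOn.add_inner_gradient_le {E : Type*} [NormedAddCommGroup E]
    [InnerProductSpace ℝ E] [CompleteSpace E] {f : E → ℝ} {f' z : E}
    (hf : ConvexOn ℝ Set.univ f) (hf' : HasGradientAt f f' z) (x : E) :
    f z + ⟪f', x - z⟫ ≤ f x := by
  have hconv : ConvexOn ℝ Set.univ (f ∘ AffineMap.lineMap (k := ℝ) z x) := by
    simpa using hf.comp_affineMap (AffineMap.lineMap (k := ℝ) z x)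
  have hderiv : HasDerivAt (f ∘ AffineMap.lineMap (k := ℝ) z x) ⟪f', x - z⟫ 0 := by
    have hz : HasFDerivAt f (InnerProductSpace.toDual ℝ E f')
        (AffineMap.lineMap (k := ℝ) z x (0 : ℝ)) := by
      simpa using hf'.hasFDerivAt
    simpa using hz.comp_hasDerivAt (0 : ℝ) AffineMap.hasDerivAt_lineMap
  have h := hconv.le_slope_of_hasDerivAt (Set.mem_univ 0) (Set.mem_univ 1) one_pos hderiv
  simp only [slope_def_field, Function.comp_apply, AffineMap.lineMap_apply_one,
    AffineMap.lineMap_apply_zero, sub_zero, div_one] at h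
  linarith

/-- If `f - ⟪·, g⟫` is minimized at `z`, then `g` is the gradient of `f` at `z`. -/
theorem HasGradientAt.eq_of_forall_inner_sub_le {E : Type*} [NormedAddCommGroup E]
    [InnerProductSpace ℝ E] [CompleteSpace E] {f : E → ℝ} {f' z g : E}
    (hf' : HasGradientAt f f' z) (h : ∀ x, ⟪x, g⟫ - f x ≤ ⟪z, g⟫ - f z) : g = f' := by
  have hmin : IsLocalMin (fun x => f x - InnerProductSpace.toDual ℝ E g x) z :=
    Filter.Eventually.of_forall fun x => by
      have := h x
      simp only [InnerProductSpace.toDual_apply_apply, real_inner_comm x g,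
        real_inner_comm z g] at this ⊢
      linarith
  have hzero := hmin.hasFDerivAt_eq_zero
    (hf'.hasFDerivAt.sub (InnerProductSpace.toDual ℝ E g).hasFDerivAt)
  exact ((InnerProductSpace.toDual ℝ E).injective (sub_eq_zero.mp hzero)).symm

/-- **Computing the dual prox-mapping associated with the conjugate `J_f` is equivalent to a
gradient computation (Lemma 3.2).**  The conjugate `J` takes values in `EReal` (it equals `+∞`
outside its domain); `Φ` is the objective of the dual prox subproblem, and the conclusion states
that `∇f(z)` is its unique minimizer. -/
theorem dual_prox_mapping_is_gradient
    {n : ℕ}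
    (f : EuclideanSpace ℝ (Fin n) → ℝ) (f' : EuclideanSpace ℝ (Fin n) → EuclideanSpace ℝ (Fin n))
    (hfconv : ConvexOn ℝ Set.univ f)
    (hfdiff : ∀ x, HasGradientAt f (f' x) x)
    (Lf : ℝ) (hLf : 0 ≤ Lf)
    (hfL : ∀ x₁ x₂, ‖f' x₁ - f' x₂‖ ≤ Lf * ‖x₁ - x₂‖)
    -- J is the convex conjugate of f
    (J : EuclideanSpace ℝ (Fin n) → EReal)
    (hJ : ∀ g, J g = ⨆ x : EuclideanSpace ℝ (Fin n), ((⟪x, g⟫ - f x : ℝ) : EReal))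
    (xt g0 : EuclideanSpace ℝ (Fin n))
    -- J is finite at g⁰ and J'g0 is a subgradient of J at g⁰
    (Jg0 : ℝ) (hJg0 : J g0 = (Jg0 : EReal))
    (J'g0 : EuclideanSpace ℝ (Fin n))
    (hJ'sub : ∀ g, (Jg0 : EReal) + ((⟪J'g0, g - g0⟫ : ℝ) : EReal) ≤ J g)
    (τ : ℝ) (hτ : 0 < τ)
    (z : EuclideanSpace ℝ (Fin n)) (hz : z = (1 + τ)⁻¹ • (xt + τ • J'g0))
    -- Φ is the objective of the dual prox subproblem ⟨−x̃, g⟩ + J(g) + τ·D_f(g⁰, g)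
    (Φ : EuclideanSpace ℝ (Fin n) → EReal)
    (hΦ : ∀ g, Φ g = ((-⟪xt, g⟫ : ℝ) : EReal) + J g
        + (τ : EReal) * (J g - (Jg0 : EReal) - ((⟪J'g0, g - g0⟫ : ℝ) : EReal))) :
    (∀ g, Φ (f' z) ≤ Φ g) ∧ (∀ g, (∀ g', Φ g ≤ Φ g') → g = f' z) := by
  have hlower : ∀ g x, ((⟪x, g⟫ - f x : ℝ) : EReal) ≤ J g := fun g x => by
    rw [hJ]
    exact le_iSup (fun x => ((⟪x, g⟫ - f x : ℝ) : EReal)) x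
  have hJz : J (f' z) = ((⟪z, f' z⟫ - f z : ℝ) : EReal) := by
    refine le_antisymm ?_ (hlower _ _)
    rw [hJ]
    refine iSup_le fun x => EReal.coe_le_coe_iff.mpr ?_
    have h := hfconv.add_inner_gradient_le (hfdiff z) x
    rw [inner_sub_right, real_inner_comm x, real_inner_comm z] at h
    linarith
  have hinner : ∀ g, (1 + τ) * ⟪z, g⟫ = ⟪xt, g⟫ + τ * ⟪J'g0, g⟫ := fun g => by
    have h1 : (1 + τ) ≠ 0 := by positivity
    rw [hz, real_inner_smul_left, inner_add_left, real_inner_smul_left,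
      mul_inv_cancel_left₀ h1]
  have hΦreal : ∀ g (j : ℝ), J g = (j : EReal) →
      Φ g = (((1 + τ) * (j - ⟪z, g⟫) + τ * (⟪J'g0, g0⟫ - Jg0) : ℝ) : EReal) := by
    intro g j hj
    rw [hΦ, hj]
    norm_cast
    rw [inner_sub_right]
    linear_combination hinner g
  have hΦtop : ∀ g, J g = ⊤ → Φ g = ⊤ := by
    intro g hg
    rw [hΦ, hg, EReal.top_sub_coe, EReal.top_sub_coe, EReal.coe_mul_top_of_pos hτ,
      EReal.coe_add_top, EReal.top_add_top]
  have hcases : ∀ g, J g = ⊤ ∨ ∃ j : ℝ, J g = (j : EReal) ∧ ∀ x, ⟪x, g⟫ - f x ≤ j := by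
    intro g
    have hl := hlower g
    generalize J g = y at hl ⊢
    induction y with
    | bot => exact absurd (le_bot_iff.mp (hl 0)) (EReal.coe_ne_bot _)
    | coe j => exact Or.inr ⟨j, rfl, fun x => EReal.coe_le_coe_iff.mp (hl x)⟩
    | top => exact Or.inl rfl
  have hpos : 0 < 1 + τ := by positivity
  refine ⟨fun g => ?_, fun g hg => ?_⟩
  · rcases hcases g with htop | ⟨j, hj, hle⟩
    · rw [hΦtop g htop]
      exact le_top
    · rw [hΦreal _ _ hJz, hΦreal g j hj, EReal.coe_le_coe_iff]
      have := hle z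
      gcongr (1 + τ) * ?_ + _
      linarith
  · have hmin := hg (f' z)
    rw [hΦreal _ _ hJz] at hmin
    rcases hcases g with htop | ⟨j, hj, hle⟩
    · rw [hΦtop g htop] at hmin
      exact absurd (top_le_iff.mp hmin) (EReal.coe_ne_top _)
    · rw [hΦreal g j hj, EReal.coe_le_coe_iff, add_le_add_iff_right,
        mul_le_mul_iff_right₀ hpos] at hmin
      exact (hfdiff z).eq_of_forall_inner_sub_le fun x => by linarith [hle x]
end

section
/- Let m ≥ 1 be an integer, μ > 0, L̂ ≥ L_i ≥ 0 for i = 1,…,m, C = L̂/μ, and define α = 1 − 1/(m + √(m² + 16mC)), τ = 1/(m(1−α)) − 1, η = αμ/(1−α), α_t ≡ mα, and θ_t = α^{−t}. Then these parameters satisfy, for all t ≥ 2 and all i = 1,…,m: θ_t(m(1+τ) − 1) = θ_{t−1}·m(1+τ); m·θ_{t−1} = α_t·θ_t; θ_t·η ≤ θ_{t−1}(μ + η); 2α_t L_i ≤ m·τ·η; and 4L_i ≤ τ(μ + η). Moreover α ≥ (2m−1)/(2m) and m(1−α) ≤ 1/2. -/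
open scoped BigOperators

/-- **Verification that the constant step-size policy of RGEM satisfies the conditions of
the general convergence proposition (with weights θ_t = α^{-t}).** -/
theorem rgem_stepsize_policy_verification
    (m : ℕ) (hm : 1 ≤ m) (μ : ℝ) (hμ : 0 < μ)
    (L : Fin m → ℝ) (Lhat : ℝ) (hL : ∀ i, 0 ≤ L i) (hLhat : ∀ i, L i ≤ Lhat)
    (C α τ η a : ℝ)
    (hC : C = Lhat / μ)
    (hα : α = 1 - 1 / ((m : ℝ) + Real.sqrt ((m : ℝ) ^ 2 + 16 * m * C)))
    (hτ : τ = 1 / (m * (1 - α)) - 1)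
    (hη : η = α * μ / (1 - α))
    (ha : a = m * α)
    (θ : ℕ → ℝ) (hθ : ∀ t : ℕ, θ t = α ^ (-(t : ℤ))) :
    (∀ t : ℕ, 2 ≤ t →
        θ t * ((m : ℝ) * (1 + τ) - 1) = θ (t - 1) * ((m : ℝ) * (1 + τ))
          ∧ (m : ℝ) * θ (t - 1) = a * θ t
          ∧ θ t * η ≤ θ (t - 1) * (μ + η))
      ∧ (∀ i, 2 * a * L i ≤ (m : ℝ) * τ * η)
      ∧ (∀ i, 4 * L i ≤ τ * (μ + η))
      ∧ (2 * (m : ℝ) - 1) / (2 * (m : ℝ)) ≤ α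
      ∧ (m : ℝ) * (1 - α) ≤ 1 / 2 := by
  have hm1 : (1 : ℝ) ≤ m := by exact_mod_cast hm
  have hm0 : (0 : ℝ) < m := by linarith
  have hLhat0 : 0 ≤ Lhat := (hL ⟨0, hm⟩).trans (hLhat ⟨0, hm⟩)
  have hC0 : 0 ≤ C := hC ▸ div_nonneg hLhat0 hμ.le
  have hCμ : C * μ = Lhat := by rw [hC]; field_simp
  set r := Real.sqrt ((m : ℝ) ^ 2 + 16 * m * C)
  have hr_sq : r ^ 2 = (m : ℝ) ^ 2 + 16 * m * C := Real.sq_sqrt (by positivity)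
  have hmr : (m : ℝ) ≤ r := Real.le_sqrt_of_sq_le (by nlinarith [mul_nonneg hm0.le hC0])
  obtain ⟨S, hS⟩ : ∃ S : ℝ, S = m + r := ⟨_, rfl⟩
  rw [← hS] at hα
  have hS2 : 2 ≤ S := by linarith
  have hS0 : 0 < S := by linarith
  have hα' : α = (S - 1) / S := by rw [hα]; field_simp
  have hα0 : 0 < α := by rw [hα']; exact div_pos (by linarith) hS0
  have hαS : α * S = S - 1 := by rw [hα']; field_simp
  have h_one_sub : 1 - α = 1 / S := by rw [hα]; ring
  have hmτ : (m : ℝ) * τ = r := by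
    rw [hτ, h_one_sub]; field_simp; linarith
  have hmτ' : (m : ℝ) * (1 + τ) = S := by linarith
  have hη' : η = (S - 1) * μ := by
    rw [hη, h_one_sub, ← hαS]; field_simp
  have hμη : μ + η = S * μ := by rw [hη']; ring
  have h_bound : ∀ i, 16 * m * L i ≤ r * S * μ := fun i => by
    have h₁ : r * S * μ = m * r * μ + m ^ 2 * μ + 16 * m * Lhat := by
      rw [hS, ← hCμ]; linear_combination μ * hr_sq
    have h₂ : (0 : ℝ) ≤ m * r * μ + m ^ 2 * μ := by positivity
    nlinarith [mul_le_mul_of_nonneg_left (hLhat i) hm0.le]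
  have h_mL : ∀ i, 0 ≤ m * L i := fun i => mul_nonneg hm0.le (hL i)
  refine ⟨fun t ht => ?_, fun i => ?_, fun i => ?_, ?_, ?_⟩
  · have h_step : θ (t - 1) = α * θ t := by
      rw [hθ, hθ, ← zpow_one_add₀ hα0.ne']
      congr 1
      omega
    rw [h_step, hmτ', hμη, hη', ha]
    refine ⟨?_, by ring, le_of_eq ?_⟩
    · linear_combination -θ t * hαS
    · linear_combination -θ t * μ * hαS
  · rw [hmτ, hη', ha, ← hαS]
    have h : 2 * m * L i ≤ r * S * μ := by linarith [h_bound i, h_mL i]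
    linarith [mul_le_mul_of_nonneg_left h hα0.le]
  · refine le_of_mul_le_mul_left ?_ hm0
    rw [hμη, ← mul_assoc (m : ℝ) τ, hmτ]
    linarith [h_bound i, h_mL i]
  · rw [hα', div_le_div_iff₀ (by positivity) hS0]
    linarith
  · rw [h_one_sub, mul_one_div, div_le_div_iff₀ hS0 two_pos]
    linarith
end
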